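/- Let G be a generalized (m,n)-ladder graph. If there exist edges a, b, e ∈ [G₁,G₂] with l(b) < l(e) < l(a) and max{r(a), r(b)} < r(e), then G contains a subdivision of K_{3,2}. -/

import Mathlib

open SimpleGraph

/-- `G` contains a subdivision of `H`: there is an injection `f` of the vertices of `H`
into the vertices of `G` and, for each edge of `H`, a path in `G` between the images of its
endpoints, such that the paths pass through no branch vertices other than their own endpoints
and paths corresponding to distinct edges are internally disjoint. -/
def ContainsSubdivision {V W : Type*} (G : SimpleGraph V) (H : SimpleGraph W) : Prop :=
  ∃ f : W → V, Function.Injective f ∧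
    ∃ p : ∀ ⦃a b : W⦄, H.Adj a b → G.Walk (f a) (f b),
      (∀ ⦃a b : W⦄ (h : H.Adj a b), (p h).IsPath) ∧
      (∀ ⦃a b : W⦄ (h : H.Adj a b) (w : W), f w ∈ (p h).support → w = a ∨ w = b) ∧
      (∀ ⦃a b a' b' : W⦄ (h : H.Adj a b) (h' : H.Adj a' b'), s(a, b) ≠ s(a', b') →
        ∀ v, v ∈ (p h).support → v ∈ (p h').support →
          (v = f a ∨ v = f b) ∧ (v = f a' ∨ v = f b'))

/-- A graph is planar iff it contains no subdivision of `K₅` or `K₃,₃` (Kuratowski). -/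
def IsPlanar {V : Type*} (G : SimpleGraph V) : Prop :=
  ¬ ContainsSubdivision G (completeGraph (Fin 5)) ∧
  ¬ ContainsSubdivision G (completeBipartiteGraph (Fin 3) (Fin 3))

/-- A graph is outerplanar iff it contains no subdivision of `K₄` or `K₃,₂`
(Chartrand–Harary). -/
def IsOuterplanar {V : Type*} (G : SimpleGraph V) : Prop :=
  ¬ ContainsSubdivision G (completeGraph (Fin 4)) ∧
  ¬ ContainsSubdivision G (completeBipartiteGraph (Fin 3) (Fin 2))

/-- The base relation of a generalized (m,n)-ladder graph: consecutive vertices on each of the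
two paths are adjacent, and `u i` is adjacent to `v j` exactly when `(i, j)` is a cross edge. -/
def ladderRel (m n : ℕ) (cross : Finset (Fin m × Fin n)) :
    Fin m ⊕ Fin n → Fin m ⊕ Fin n → Prop
  | Sum.inl i, Sum.inl j => (i : ℕ) + 1 = (j : ℕ)
  | Sum.inr i, Sum.inr j => (i : ℕ) + 1 = (j : ℕ)
  | Sum.inl i, Sum.inr j => (i, j) ∈ cross
  | Sum.inr _, Sum.inl _ => False

/-- The generalized (m,n)-ladder graph determined by the set `cross` of cross edges
`[G₁, G₂]`.  Vertices `Sum.inl i` are the vertices `u_{i+1}` of the path `G₁` and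
vertices `Sum.inr j` are the vertices `v_{j+1}` of the path `G₂`. -/
def ladderGraph (m n : ℕ) (cross : Finset (Fin m × Fin n)) :
    SimpleGraph (Fin m ⊕ Fin n) :=
  SimpleGraph.fromRel (ladderRel m n cross)

/-- `L↑(e)`: the cross edges `e'` with `l(e) < l(e')`. -/
def Lup {m n : ℕ} (cross : Finset (Fin m × Fin n)) (e : Fin m × Fin n) :
    Finset (Fin m × Fin n) := cross.filter fun e' => e.1 < e'.1

/-- `L↓(e)`: the cross edges `e'` with `l(e') < l(e)`. -/
def Ldown {m n : ℕ} (cross : Finset (Fin m × Fin n)) (e : Fin m × Fin n) :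
    Finset (Fin m × Fin n) := cross.filter fun e' => e'.1 < e.1

/-- `R↑(e)`: the cross edges `e'` with `r(e) < r(e')`. -/
def Rup {m n : ℕ} (cross : Finset (Fin m × Fin n)) (e : Fin m × Fin n) :
    Finset (Fin m × Fin n) := cross.filter fun e' => e.2 < e'.2

/-- `R↓(e)`: the cross edges `e'` with `r(e') < r(e)`. -/
def Rdown {m n : ℕ} (cross : Finset (Fin m × Fin n)) (e : Fin m × Fin n) :
    Finset (Fin m × Fin n) := cross.filter fun e' => e'.2 < e.2

/-- To exhibit a subdivision of a complete bipartite graph it suffices to give walks joining the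
two sides that stay inside sets meeting only in branch vertices. -/
lemma ContainsSubdivision.completeBipartiteGraph_of_walks {V α β : Type*} {G : SimpleGraph V}
    (f : α ⊕ β → V) (hf : Function.Injective f) (S : α → β → Set V)
    (hw : ∀ i j, ∃ p : G.Walk (f (.inl i)) (f (.inr j)), ∀ v ∈ p.support, v ∈ S i j)
    (hb : ∀ i j w, f w ∈ S i j → w = .inl i ∨ w = .inr j)
    (hd : ∀ i j i' j', (i ≠ i' ∨ j ≠ j') → ∀ v ∈ S i j, v ∈ S i' j' → ∃ w, v = f w) :
    ContainsSubdivision G (completeBipartiteGraph α β) := by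
  classical
  choose p hp using hw
  let q : ∀ ⦃a b : α ⊕ β⦄, (completeBipartiteGraph α β).Adj a b → G.Walk (f a) (f b)
    | .inl i, .inr j, _ => (p i j).bypass
    | .inr j, .inl i, _ => (p i j).bypass.reverse
    | .inl _, .inl _, h => absurd h (by simp)
    | .inr _, .inr _, h => absurd h (by simp)
  have hq : ∀ ⦃a b : α ⊕ β⦄ (h : (completeBipartiteGraph α β).Adj a b),
      (q h).IsPath ∧ ∃ i j, s(a, b) = s(.inl i, .inr j) ∧ ∀ v ∈ (q h).support, v ∈ S i j := by
    rintro (i | j) (i' | j') h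
    · simp at h
    · exact ⟨(p i j').bypass_isPath, i, j', rfl,
        fun v hv => hp i j' v ((p i j').support_bypass_subset_support hv)⟩
    · refine ⟨(p i' j).bypass_isPath.reverse, i', j, Sym2.eq_swap, fun v hv => ?_⟩
      have hv' : v ∈ (p i' j).bypass.reverse.support := hv
      rw [Walk.support_reverse, List.mem_reverse] at hv'
      exact hp i' j v ((p i' j).support_bypass_subset_support hv')
    · simp at h
  have hbranch : ∀ ⦃a b : α ⊕ β⦄ (h : (completeBipartiteGraph α β).Adj a b) (w : α ⊕ β),
      f w ∈ (q h).support → w = a ∨ w = b := by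
    intro a b h w hw
    obtain ⟨-, i, j, hs, hS⟩ := hq h
    rw [← Sym2.mem_iff, hs, Sym2.mem_iff]
    exact hb i j w (hS _ hw)
  refine ⟨f, hf, q, fun a b h => (hq h).1, hbranch, ?_⟩
  intro a b a' b' h h' hne v hv hv'
  obtain ⟨-, i, j, hs, hS⟩ := hq h
  obtain ⟨-, i', j', hs', hS'⟩ := hq h'
  obtain ⟨w, rfl⟩ := hd i j i' j' (by
    by_contra! hcon
    exact hne (by rw [hs, hs', hcon.1, hcon.2])) v (hS v hv) (hS' v hv')
  exact ⟨(hbranch h w hv).imp (congrArg f) (congrArg f),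
    (hbranch h' w hv').imp (congrArg f) (congrArg f)⟩

/-- A sequence of vertices with consecutive terms adjacent contains a walk between any two of its
terms that stays between them. -/
lemma SimpleGraph.exists_walk_of_adj_succ {V : Type*} {G : SimpleGraph V} {n : ℕ} (g : Fin n → V)
    (hg : ∀ i j : Fin n, (i : ℕ) + 1 = j → G.Adj (g i) (g j)) (i j : Fin n) :
    ∃ p : G.Walk (g i) (g j), ∀ v ∈ p.support, ∃ k ∈ Set.uIcc i j, v = g k := by
  have key : ∀ d (i j : Fin n), (i : ℕ) + d = j →
      ∃ p : G.Walk (g i) (g j), ∀ v ∈ p.support, ∃ k, i ≤ k ∧ k ≤ j ∧ v = g k := by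
    intro d
    induction d with
    | zero =>
      intro i j h
      obtain rfl : i = j := Fin.ext h
      exact ⟨.nil, fun v hv => ⟨i, le_rfl, le_rfl, by simpa using hv⟩⟩
    | succ d ih =>
      intro i j h
      obtain ⟨p, hp⟩ := ih ⟨i + 1, by omega⟩ j (by simp only; omega)
      refine ⟨.cons (hg i _ rfl) p, fun v hv => ?_⟩
      rw [Walk.support_cons, List.mem_cons] at hv
      rcases hv with rfl | hv
      · exact ⟨i, le_rfl, Fin.le_def.2 (by omega), rfl⟩
      · obtain ⟨k, hk, hkj, rfl⟩ := hp v hv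
        exact ⟨k, Fin.le_def.2 (by rw [Fin.le_def] at hk; simp only at hk; omega), hkj, rfl⟩
  rcases le_total i j with h | h
  · obtain ⟨p, hp⟩ := key (j - i) i j (by rw [Fin.le_def] at h; omega)
    exact ⟨p, fun v hv => by simpa [Set.uIcc_of_le h, and_assoc] using hp v hv⟩
  · obtain ⟨p, hp⟩ := key (i - j) j i (by rw [Fin.le_def] at h; omega)
    refine ⟨p.reverse, fun v hv => ?_⟩
    rw [Walk.support_reverse, List.mem_reverse] at hv
    simpa [Set.uIcc_of_ge h, and_assoc] using hp v hv

section ladderGraph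

variable {m n : ℕ} {cross : Finset (Fin m × Fin n)}

lemma ladderGraph_adj_inl_inr {c : Fin m × Fin n} (hc : c ∈ cross) :
    (ladderGraph m n cross).Adj (.inl c.1) (.inr c.2) := by
  simp [ladderGraph, ladderRel, hc]

lemma ladderGraph_exists_walk_inl (i j : Fin m) :
    ∃ p : (ladderGraph m n cross).Walk (.inl i) (.inl j),
      ∀ v ∈ p.support, ∃ k ∈ Set.uIcc i j, v = .inl k :=
  exists_walk_of_adj_succ _ (fun i j h => by
    simp [ladderGraph, ladderRel, h, Fin.ext_iff]; omega) i j

lemma ladderGraph_exists_walk_inr (i j : Fin n) :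
    ∃ p : (ladderGraph m n cross).Walk (.inr i) (.inr j),
      ∀ v ∈ p.support, ∃ k ∈ Set.uIcc i j, v = .inr k :=
  exists_walk_of_adj_succ _ (fun i j h => by
    simp [ladderGraph, ladderRel, h, Fin.ext_iff]; omega) i j

set_option maxHeartbeats 1000000 in
/-- Three cross edges, the left end of `e` strictly between those of `a` and `b` and the right ends
ordered as `b`, `a`, `e`, give a subdivision of `K₃,₂` with hubs the left end of `e` and the right
end of `a`. -/
lemma ladderGraph_containsSubdivision_of_le {a b e : Fin m × Fin n}
    (ha : a ∈ cross) (hb : b ∈ cross) (he : e ∈ cross)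
    (hl : b.1 < e.1 ∧ e.1 < a.1 ∨ a.1 < e.1 ∧ e.1 < b.1) (hba : b.2 ≤ a.2) (hae : a.2 < e.2) :
    ContainsSubdivision (ladderGraph m n cross)
      (completeBipartiteGraph (Fin 3) (Fin 2)) := by
  obtain ⟨a₁, a₂⟩ := a
  obtain ⟨b₁, b₂⟩ := b
  obtain ⟨e₁, e₂⟩ := e
  simp only at hl hba hae
  let S : Fin 3 → Fin 2 → Set (Fin m ⊕ Fin n) :=
    ![![Sum.inl '' Set.uIcc b₁ e₁, insert (.inl b₁) (Sum.inr '' Set.uIcc b₂ a₂)],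
      ![Sum.inl '' Set.uIcc a₁ e₁, {.inl a₁, .inr a₂}],
      ![{.inr e₂, .inl e₁}, Sum.inr '' Set.uIcc e₂ a₂]]
  refine ContainsSubdivision.completeBipartiteGraph_of_walks
    (Sum.elim ![.inl b₁, .inl a₁, .inr e₂] ![.inl e₁, .inr a₂]) ?_ S ?_ ?_ ?_
  · rintro (i | i) (j | j) h <;> fin_cases i <;> fin_cases j <;> simp at h ⊢ <;> grind
  · obtain ⟨p, hp⟩ := ladderGraph_exists_walk_inl (cross := cross) b₁ e₁
    obtain ⟨q, hq⟩ := ladderGraph_exists_walk_inr (cross := cross) b₂ a₂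
    obtain ⟨r, hr⟩ := ladderGraph_exists_walk_inl (cross := cross) a₁ e₁
    obtain ⟨s, hs⟩ := ladderGraph_exists_walk_inr (cross := cross) e₂ a₂
    intro i j
    fin_cases i <;> fin_cases j
    · exact ⟨p, fun v hv => by obtain ⟨k, hk, rfl⟩ := hp v hv; exact ⟨k, hk, rfl⟩⟩
    · refine ⟨.cons (ladderGraph_adj_inl_inr hb) q, fun v hv => ?_⟩
      rcases List.mem_cons.1 hv with rfl | hv
      · exact .inl rfl
      · obtain ⟨k, hk, rfl⟩ := hq v hv
        exact .inr ⟨k, hk, rfl⟩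
    · exact ⟨r, fun v hv => by obtain ⟨k, hk, rfl⟩ := hr v hv; exact ⟨k, hk, rfl⟩⟩
    · exact ⟨(ladderGraph_adj_inl_inr ha).toWalk, fun v hv => by simpa [S] using hv⟩
    · exact ⟨(ladderGraph_adj_inl_inr he).symm.toWalk, fun v hv => by simpa [S] using hv⟩
    · exact ⟨s, fun v hv => by obtain ⟨k, hk, rfl⟩ := hs v hv; exact ⟨k, hk, rfl⟩⟩
  · rintro i j (w | w) h <;> fin_cases i <;> fin_cases j <;> fin_cases w <;>
      simp [S, Set.uIcc_of_le hba, Set.uIcc_of_ge hae.le, Set.mem_uIcc] at h ⊢ <;> omega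
  · intro i j i' j' hne v hv hv'
    simp only [Sum.exists, Fin.exists_fin_succ, Sum.elim_inl, Sum.elim_inr]
    rcases v with v | v <;> fin_cases i <;> fin_cases j <;> fin_cases i' <;> fin_cases j' <;>
      simp [S, Set.uIcc_of_le hba, Set.uIcc_of_ge hae.le, Set.mem_uIcc] at hne hv hv' ⊢ <;> omega

end ladderGraph

/-- If there are cross edges `a`, `b`, `e` with `l(b) < l(e) < l(a)` and
`max (r(a)) (r(b)) < r(e)`, then the generalized ladder graph contains a subdivision of
`K₃,₂`. -/
theorem ladder_containsSubdivision_K32 (m n : ℕ) (hm : 0 < m) (hn : 0 < n)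
    (cross : Finset (Fin m × Fin n)) (a b e : Fin m × Fin n)
    (ha : a ∈ cross) (hb : b ∈ cross) (he : e ∈ cross)
    (h1 : b.1 < e.1) (h2 : e.1 < a.1) (h3 : max a.2 b.2 < e.2) :
    ContainsSubdivision (ladderGraph m n cross)
      (completeBipartiteGraph (Fin 3) (Fin 2)) := by
  rcases le_total b.2 a.2 with h | h
  · exact ladderGraph_containsSubdivision_of_le ha hb he (.inl ⟨h1, h2⟩) h (max_lt_iff.1 h3).1
  · exact ladderGraph_containsSubdivision_of_le hb ha he (.inr ⟨h1, h2⟩) h (max_lt_iff.1 h3).2
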